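/- Fix a nonempty finite action set A. For every ε > 0 there exists N such that for every finite state set Ω with |Ω| ≥ N, every finite message set M with |M| > max{|Ω|, |A|}, and every interior prior μ₀ on Ω, the absolute difference between the share of environments such that commitment has no value and the share of environments that are felicitous is less than ε. -/

import Mathlib

open MeasureTheory

namespace KL

/-- `f` is a probability distribution on the finite type `X`. -/
def IsDist {X : Type} [Fintype X] (f : X → ℝ) : Prop :=
  (∀ x, 0 ≤ f x) ∧ ∑ x, f x = 1

/-- `μ₀` is an interior prior on `Ω`. -/
def IsPrior {Ω : Type} [Fintype Ω] (μ₀ : Ω → ℝ) : Prop :=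
  (∀ ω, 0 < μ₀ ω) ∧ ∑ ω, μ₀ ω = 1

variable {Ω A M : Type} [Fintype Ω] [Fintype A] [Fintype M]

/-- A messaging strategy: a distribution over messages in each state. -/
def IsMsg (σ : Ω → M → ℝ) : Prop := ∀ ω, IsDist (σ ω)

/-- An action strategy: a distribution over actions after each message. -/
def IsAct (ρ : M → A → ℝ) : Prop := ∀ m, IsDist (ρ m)

/-- Expected payoff of a profile `(σ, ρ)` for utility `u`. -/
def U (μ₀ : Ω → ℝ) (u : A × Ω → ℝ) (σ : Ω → M → ℝ) (ρ : M → A → ℝ) : ℝ :=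
  ∑ ω, ∑ m, ∑ a, μ₀ ω * σ ω m * ρ m a * u (a, ω)

/-- Sender best response. -/
def SBR (μ₀ : Ω → ℝ) (uS : A × Ω → ℝ) (σ : Ω → M → ℝ) (ρ : M → A → ℝ) : Prop :=
  ∀ σ' : Ω → M → ℝ, IsMsg σ' → U μ₀ uS σ' ρ ≤ U μ₀ uS σ ρ

/-- Receiver best response. -/
def RBR (μ₀ : Ω → ℝ) (uR : A × Ω → ℝ) (σ : Ω → M → ℝ) (ρ : M → A → ℝ) : Prop :=
  ∀ ρ' : M → A → ℝ, IsAct ρ' → U μ₀ uR σ ρ' ≤ U μ₀ uR σ ρ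

/-- A cheap-talk equilibrium: a profile of valid strategies that is S-BR and R-BR. -/
def CTEq (μ₀ : Ω → ℝ) (uS uR : A × Ω → ℝ) (σ : Ω → M → ℝ) (ρ : M → A → ℝ) : Prop :=
  IsMsg σ ∧ IsAct ρ ∧ SBR μ₀ uS σ ρ ∧ RBR μ₀ uR σ ρ

/-- A persuasion profile: a profile of valid strategies that is R-BR. -/
def PersProfile (μ₀ : Ω → ℝ) (uR : A × Ω → ℝ) (σ : Ω → M → ℝ) (ρ : M → A → ℝ) : Prop :=
  IsMsg σ ∧ IsAct ρ ∧ RBR μ₀ uR σ ρ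

/-- The cheap-talk payoff: the maximal Sender payoff over cheap-talk equilibria. -/
noncomputable def ctPayoff (μ₀ : Ω → ℝ) (uS uR : A × Ω → ℝ) : ℝ :=
  sSup {x | ∃ (σ : Ω → M → ℝ) (ρ : M → A → ℝ), CTEq μ₀ uS uR σ ρ ∧ x = U μ₀ uS σ ρ}

/-- The (Bayesian) persuasion payoff: the maximal Sender payoff over persuasion profiles. -/
noncomputable def persPayoff (μ₀ : Ω → ℝ) (uS uR : A × Ω → ℝ) : ℝ :=
  sSup {x | ∃ (σ : Ω → M → ℝ) (ρ : M → A → ℝ), PersProfile μ₀ uR σ ρ ∧ x = U μ₀ uS σ ρ}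

/-- A messaging strategy is partitional if it is deterministic in every state. -/
def Partitional (σ : Ω → M → ℝ) : Prop := ∀ ω, ∃ m, σ ω m = 1

/-- The partitional persuasion payoff. -/
noncomputable def partPersPayoff (μ₀ : Ω → ℝ) (uS uR : A × Ω → ℝ) : ℝ :=
  sSup {x | ∃ (σ : Ω → M → ℝ) (ρ : M → A → ℝ),
    Partitional σ ∧ PersProfile μ₀ uR σ ρ ∧ x = U μ₀ uS σ ρ}

/-- The partitional cheap-talk payoff. -/
noncomputable def partCtPayoff (μ₀ : Ω → ℝ) (uS uR : A × Ω → ℝ) : ℝ :=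
  sSup {x | ∃ (σ : Ω → M → ℝ) (ρ : M → A → ℝ),
    Partitional σ ∧ CTEq μ₀ uS uR σ ρ ∧ x = U μ₀ uS σ ρ}

/-- A message is on-path if it is sent with positive probability in some state. -/
def OnPath (σ : Ω → M → ℝ) (m : M) : Prop := ∃ ω, 0 < σ ω m

/-- A pure action strategy: degenerate after every message. -/
def IsPureAct (ρ : M → A → ℝ) : Prop := ∀ m, ∃ a, ρ m a = 1

/-- A pure-on-path action strategy: degenerate after every on-path message. -/
def PureOnPath (σ : Ω → M → ℝ) (ρ : M → A → ℝ) : Prop :=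
  ∀ m, OnPath σ m → ∃ a, ρ m a = 1

/-- The posterior belief induced by message `m`. -/
noncomputable def post (μ₀ : Ω → ℝ) (σ : Ω → M → ℝ) (m : M) (ω : Ω) : ℝ :=
  μ₀ ω * σ ω m / ∑ ω', μ₀ ω' * σ ω' m

/-- The cube of environments `[0,1]^(2|A||Ω|)`. -/
def EnvCube (Ω A : Type) : Set ((A × Ω → ℝ) × (A × Ω → ℝ)) :=
  {e | (∀ p, e.1 p ∈ Set.Icc (0 : ℝ) 1) ∧ ∀ p, e.2 p ∈ Set.Icc (0 : ℝ) 1}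

/-- The cube of transparent environments `[0,1]^(|A|(|Ω|+1))`, points `(v, u_R)`. -/
def TransCube (Ω A : Type) : Set ((A → ℝ) × (A × Ω → ℝ)) :=
  {e | (∀ a, e.1 a ∈ Set.Icc (0 : ℝ) 1) ∧ ∀ p, e.2 p ∈ Set.Icc (0 : ℝ) 1}

open Classical in
/-- The expanded-indifference matrix `T^i`: rows `u_S(a_j,·) − u_S(a_i,·)` for `j ≠ i`,
rows `u_R(a_j,·) − u_R(a_i,·)` for `j ≠ i`, and the rows of the identity matrix. -/
noncomputable def TMat (uS uR : A × Ω → ℝ) (i : A) :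
    Matrix (({j : A // j ≠ i} ⊕ {j : A // j ≠ i}) ⊕ Ω) Ω ℝ :=
  Matrix.of fun r ω =>
    match r with
    | Sum.inl (Sum.inl j) => uS (j.1, ω) - uS (i, ω)
    | Sum.inl (Sum.inr j) => uR (j.1, ω) - uR (i, ω)
    | Sum.inr ω' => if ω' = ω then 1 else 0

/-- Scant indifferences: every row-submatrix of every expanded-indifference matrix has
full rank (rank equal to the minimum of the number of rows and the number of columns). -/
def ScantIndiff (uS uR : A × Ω → ℝ) : Prop :=
  ∀ i : A, ∀ s : Finset (({j : A // j ≠ i} ⊕ {j : A // j ≠ i}) ⊕ Ω),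
    ((TMat uS uR i).submatrix (fun r : {x // x ∈ s} => r.1) id).rank
      = min s.card (Fintype.card Ω)

open Classical in
/-- The set `Ω_a` of states in which `a` is an ideal action for Sender. -/
noncomputable def idealStates (uS : A × Ω → ℝ) (a : A) : Finset Ω :=
  Finset.univ.filter fun ω => ∀ b, uS (b, ω) ≤ uS (a, ω)

/-- Felicitous environment. -/
def Felicitous (μ₀ : Ω → ℝ) (uS uR : A × Ω → ℝ) : Prop :=
  ∀ a a' : A, 0 ≤ ∑ ω ∈ idealStates uS a, μ₀ ω * (uR (a, ω) - uR (a', ω))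

/-- Partitional-unique-response: for every nonempty subset of states, Receiver's
expected payoff has a unique maximizer. -/
def PUR (μ₀ : Ω → ℝ) (uR : A × Ω → ℝ) : Prop :=
  ∀ S : Finset Ω, S.Nonempty →
    ∃! a : A, ∀ b : A, ∑ ω ∈ S, μ₀ ω * uR (b, ω) ≤ ∑ ω ∈ S, μ₀ ω * uR (a, ω)

/-- Jointly-inclusive environment: each action is the unique ideal action of both
players in some state. -/
def JointlyInclusive (uS uR : A × Ω → ℝ) : Prop :=
  ∀ a : A, ∃ ω : Ω,
    (∀ b, b ≠ a → uS (b, ω) < uS (a, ω)) ∧ ∀ b, b ≠ a → uR (b, ω) < uR (a, ω)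

set_option linter.all false

/-! ### Outcomes -/

/-- The outcome (joint distribution of action and state) induced by a profile. -/
def out (μ₀ : Ω → ℝ) (σ : Ω → M → ℝ) (ρ : M → A → ℝ) : A × Ω → ℝ :=
  fun p => ∑ m, μ₀ p.2 * σ p.2 m * ρ m p.1

/-- Expected utility of an outcome. -/
def ip (x u : A × Ω → ℝ) : ℝ := ∑ ω, ∑ a, x (a, ω) * u (a, ω)

/-- Obedient outcomes. -/
def Feas (μ₀ : Ω → ℝ) (uR : A × Ω → ℝ) : Set (A × Ω → ℝ) :=
  {x | (∀ p, 0 ≤ x p) ∧ (∀ ω, ∑ a, x (a, ω) = μ₀ ω) ∧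
    ∀ a b, 0 ≤ ∑ ω, x (a, ω) * (uR (a, ω) - uR (b, ω))}

lemma U_eq (μ₀ : Ω → ℝ) (u : A × Ω → ℝ) (σ : Ω → M → ℝ) (ρ : M → A → ℝ) :
    U μ₀ u σ ρ = ip (out μ₀ σ ρ) u := by
  unfold U ip out
  refine Finset.sum_congr rfl fun ω _ => ?_
  rw [Finset.sum_comm]
  refine Finset.sum_congr rfl fun a _ => ?_
  rw [Finset.sum_mul]

lemma out_sum {μ₀ : Ω → ℝ} {σ : Ω → M → ℝ} {ρ : M → A → ℝ} (hσ : IsMsg σ) (hρ : IsAct ρ)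
    (ω : Ω) : ∑ a, out μ₀ σ ρ (a, ω) = μ₀ ω := by
  unfold out
  rw [Finset.sum_comm]
  have : ∀ m, ∑ a, μ₀ ω * σ ω m * ρ m a = μ₀ ω * σ ω m := fun m => by
    rw [← Finset.mul_sum, (hρ m).2, mul_one]
  simp only [this]
  rw [← Finset.mul_sum, (hσ ω).2, mul_one]

lemma out_nonneg {μ₀ : Ω → ℝ} (hμ : IsPrior μ₀) {σ : Ω → M → ℝ} {ρ : M → A → ℝ}
    (hσ : IsMsg σ) (hρ : IsAct ρ) (p : A × Ω) : 0 ≤ out μ₀ σ ρ p :=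
  Finset.sum_nonneg fun m _ => mul_nonneg (mul_nonneg (hμ.1 _).le ((hσ _).1 _)) ((hρ _).1 _)

open Classical in
/-- Move mass `t m` from action `a` to action `b` after message `m`. -/
noncomputable def devR (ρ : M → A → ℝ) (a b : A) (t : M → ℝ) : M → A → ℝ :=
  fun m c => ρ m c + t m * ((if c = b then 1 else 0) - (if c = a then 1 else 0))

lemma devR_isAct {ρ : M → A → ℝ} (hρ : IsAct ρ) (a b : A) {t : M → ℝ}
    (h0 : ∀ m, 0 ≤ t m) (h1 : ∀ m, t m ≤ ρ m a) : IsAct (devR ρ a b t) := by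
  classical
  intro m
  refine ⟨fun c => ?_, ?_⟩
  · have := (hρ m).1 c
    have h2 := h0 m
    have h3 := h1 m
    unfold devR
    by_cases hb : c = b <;> by_cases ha : c = a <;> simp only [hb, ha, if_true, if_false] <;>
      (try subst hb) <;> (try subst ha) <;> simp_all <;> linarith [h0 m]
  · unfold devR
    rw [Finset.sum_add_distrib, (hρ m).2, ← Finset.mul_sum, Finset.sum_sub_distrib]
    simp

lemma out_devR (μ₀ : Ω → ℝ) (σ : Ω → M → ℝ) (ρ : M → A → ℝ) (a b : A) (t : M → ℝ)
    [DecidableEq A] (p : A × Ω) :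
    out μ₀ σ (devR ρ a b t) p = out μ₀ σ ρ p +
      (∑ m, μ₀ p.2 * σ p.2 m * t m) * ((if p.1 = b then 1 else 0) - (if p.1 = a then 1 else 0)) := by
  unfold out devR
  rw [Finset.sum_mul, ← Finset.sum_add_distrib]
  refine Finset.sum_congr rfl fun m _ => ?_
  by_cases hb : p.1 = b <;> by_cases ha : p.1 = a <;> simp [hb, ha] <;> ring

lemma ip_add_ind [DecidableEq A] (x u : A × Ω → ℝ) (a b : A) (w : Ω → ℝ) :
    ip (fun p => x p + w p.2 * ((if p.1 = b then 1 else 0) - (if p.1 = a then 1 else 0))) u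
      = ip x u + ∑ ω, w ω * (u (b, ω) - u (a, ω)) := by
  unfold ip
  rw [← Finset.sum_add_distrib]
  refine Finset.sum_congr rfl fun ω _ => ?_
  simp only [add_mul, Finset.sum_add_distrib, mul_sub, sub_mul, Finset.sum_sub_distrib]
  simp

lemma U_devR (μ₀ : Ω → ℝ) (u : A × Ω → ℝ) (σ : Ω → M → ℝ) (ρ : M → A → ℝ) (a b : A)
    (t : M → ℝ) : U μ₀ u σ (devR ρ a b t) = U μ₀ u σ ρ +
      ∑ ω, (∑ m, μ₀ ω * σ ω m * t m) * (u (b, ω) - u (a, ω)) := by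
  classical
  rw [U_eq, U_eq, ← ip_add_ind]
  congr 1
  funext p
  rw [out_devR]

lemma out_mem_Feas {μ₀ : Ω → ℝ} (hμ : IsPrior μ₀) {uR : A × Ω → ℝ} {σ : Ω → M → ℝ}
    {ρ : M → A → ℝ} (h : PersProfile μ₀ uR σ ρ) : out μ₀ σ ρ ∈ Feas μ₀ uR := by
  obtain ⟨hσ, hρ, hR⟩ := h
  refine ⟨out_nonneg hμ hσ hρ, out_sum hσ hρ, fun a b => ?_⟩
  have h1 := hR _ (devR_isAct hρ a b (t := fun m => ρ m a) (fun m => (hρ m).1 a) (fun m => le_rfl))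
  rw [U_devR] at h1
  have : ∑ ω, (∑ m, μ₀ ω * σ ω m * ρ m a) * (uR (b, ω) - uR (a, ω)) =
      - ∑ ω, out μ₀ σ ρ (a, ω) * (uR (a, ω) - uR (b, ω)) := by
    rw [← Finset.sum_neg_distrib]
    refine Finset.sum_congr rfl fun ω _ => ?_
    unfold out; ring
  linarith

/-- Every obedient outcome is induced by a persuasion profile. -/
lemma exists_profile [Nonempty A] {μ₀ : Ω → ℝ} (hμ : IsPrior μ₀) {uR : A × Ω → ℝ}
    (hM : Fintype.card A < Fintype.card M) {x : A × Ω → ℝ} (hx : x ∈ Feas μ₀ uR) :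
    ∃ (σ : Ω → M → ℝ) (ρ : M → A → ℝ), PersProfile μ₀ uR σ ρ ∧ out μ₀ σ ρ = x := by
  classical
  obtain ⟨ι⟩ := Function.Embedding.nonempty_of_card_le hM.le
  obtain ⟨hx0, hx1, hx2⟩ := hx
  set g := Function.invFun ι with hg
  have hgι : ∀ a, g (ι a) = a := Function.leftInverse_invFun ι.injective
  let σ : Ω → M → ℝ := fun ω m => ∑ a, if m = ι a then x (a, ω) / μ₀ ω else 0
  let ρ : M → A → ℝ := fun m a => if a = g m then 1 else 0
  have hout : ∀ (ρ' : M → A → ℝ) p, out μ₀ σ ρ' p = ∑ a', x (a', p.2) * ρ' (ι a') p.1 := by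
    intro ρ' p
    have hμp := (hμ.1 p.2).ne'
    simp only [out, σ, Finset.mul_sum, Finset.sum_mul]
    rw [Finset.sum_comm]
    refine Finset.sum_congr rfl fun a' _ => ?_
    simp only [mul_ite, ite_mul, mul_zero, zero_mul]
    rw [Finset.sum_ite_eq' Finset.univ (ι a')]
    simp only [Finset.mem_univ, if_true]
    field_simp
  have houtρ : out μ₀ σ ρ = x := by
    funext p
    rw [hout]
    simp [ρ, hgι]
  refine ⟨σ, ρ, ⟨fun ω => ⟨fun m => ?_, ?_⟩, fun m => ⟨fun a => ?_, ?_⟩, fun ρ' hρ' => ?_⟩, houtρ⟩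
  · refine Finset.sum_nonneg fun a _ => ?_
    split_ifs
    · exact div_nonneg (hx0 _) (hμ.1 _).le
    · exact le_rfl
  · simp only [σ]
    rw [Finset.sum_comm]
    simp only [Finset.sum_ite_eq', Finset.mem_univ, if_true]
    rw [← Finset.sum_div, hx1, div_self (hμ.1 _).ne']
  · simp only [ρ]; split_ifs <;> norm_num
  · simp [ρ]
  · rw [U_eq, U_eq, houtρ]
    have e1 : ip (out μ₀ σ ρ') uR
        = ∑ a', ∑ a, ρ' (ι a') a * ∑ ω, x (a', ω) * uR (a, ω) := by
      unfold ip
      simp only [hout, Finset.sum_mul, Finset.mul_sum]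
      rw [Finset.sum_comm]
      rw [Finset.sum_comm (s := Finset.univ (α := A)) (t := Finset.univ (α := A))]
      refine Finset.sum_congr rfl fun a' _ => ?_
      rw [Finset.sum_comm]
      refine Finset.sum_congr rfl fun a _ => ?_
      refine Finset.sum_congr rfl fun ω _ => ?_
      ring
    have e2 : ip x uR = ∑ a', ∑ a, ρ' (ι a') a * ∑ ω, x (a', ω) * uR (a', ω) := by
      unfold ip
      rw [Finset.sum_comm]
      refine Finset.sum_congr rfl fun a' _ => ?_
      rw [← Finset.sum_mul, (hρ' _).2, one_mul]
    rw [e1, e2]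
    refine Finset.sum_le_sum fun a' _ => Finset.sum_le_sum fun a _ => ?_
    refine mul_le_mul_of_nonneg_left ?_ ((hρ' _).1 _)
    have := hx2 a' a
    simp only [mul_sub, Finset.sum_sub_distrib] at this
    linarith

open Classical in
/-- Move the mass that state `ω` puts on `m1` to `m2`. -/
noncomputable def devS (σ : Ω → M → ℝ) (ω : Ω) (m1 m2 : M) : Ω → M → ℝ :=
  fun ω' m => σ ω' m + if ω' = ω then
    σ ω m1 * ((if m = m2 then 1 else 0) - (if m = m1 then 1 else 0)) else 0

lemma devS_isMsg {σ : Ω → M → ℝ} (hσ : IsMsg σ) (ω : Ω) (m1 m2 : M) :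
    IsMsg (devS σ ω m1 m2) := by
  classical
  intro ω'
  refine ⟨fun m => ?_, ?_⟩
  · have h1 := (hσ ω').1 m
    have h2 := (hσ ω).1 m1
    unfold devS
    by_cases h : ω' = ω
    · subst h
      by_cases hb : m = m2 <;> by_cases ha : m = m1 <;> simp only [hb, ha, if_true, if_false] <;>
        (try subst hb) <;> (try subst ha) <;> simp_all <;> linarith
    · simpa [h] using h1
  · unfold devS
    rw [Finset.sum_add_distrib, (hσ ω').2]
    by_cases h : ω' = ω
    · simp only [h, if_true]
      rw [← Finset.mul_sum, Finset.sum_sub_distrib]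
      simp
    · simp [h]

lemma U_devS (μ₀ : Ω → ℝ) (u : A × Ω → ℝ) (σ : Ω → M → ℝ) (ρ : M → A → ℝ) (ω : Ω)
    (m1 m2 : M) : U μ₀ u (devS σ ω m1 m2) ρ = U μ₀ u σ ρ +
      μ₀ ω * σ ω m1 * (∑ a, ρ m2 a * u (a, ω) - ∑ a, ρ m1 a * u (a, ω)) := by
  classical
  have key : ∀ σ : Ω → M → ℝ, U μ₀ u σ ρ = ∑ ω, ∑ m, σ ω m * (μ₀ ω * ∑ a, ρ m a * u (a, ω)) := by
    intro σ
    unfold U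
    refine Finset.sum_congr rfl fun ω _ => Finset.sum_congr rfl fun m _ => ?_
    simp only [Finset.mul_sum]
    refine Finset.sum_congr rfl fun a _ => ?_
    ring
  rw [key, key]
  unfold devS
  simp only [add_mul, Finset.sum_add_distrib]
  congr 1
  rw [Finset.sum_eq_single ω]
  · simp only [if_true, mul_sub, sub_mul, Finset.sum_sub_distrib]
    simp
    ring
  · intro b _ hb
    simp [hb]
  · simp

/-! ### Payoffs -/

lemma ip_le_of_le {μ₀ : Ω → ℝ} {x u : A × Ω → ℝ} (h0 : ∀ p, 0 ≤ x p)
    (h1 : ∀ ω, ∑ a, x (a, ω) = μ₀ ω) {c : Ω → ℝ} (hc : ∀ a ω, u (a, ω) ≤ c ω) :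
    ip x u ≤ ∑ ω, μ₀ ω * c ω := by
  refine Finset.sum_le_sum fun ω _ => ?_
  rw [← h1, Finset.sum_mul]
  exact Finset.sum_le_sum fun a _ => mul_le_mul_of_nonneg_left (hc a ω) (h0 _)

lemma U_le_of_le {μ₀ : Ω → ℝ} (hμ : IsPrior μ₀) {u : A × Ω → ℝ} {σ : Ω → M → ℝ}
    {ρ : M → A → ℝ} (hσ : IsMsg σ) (hρ : IsAct ρ) {c : Ω → ℝ} (hc : ∀ a ω, u (a, ω) ≤ c ω) :
    U μ₀ u σ ρ ≤ ∑ ω, μ₀ ω * c ω := by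
  rw [U_eq]
  exact ip_le_of_le (out_nonneg hμ hσ hρ) (out_sum hσ hρ) hc

lemma le_sum_abs (u : A × Ω → ℝ) (a : A) (ω : Ω) : u (a, ω) ≤ ∑ a, |u (a, ω)| :=
  (le_abs_self _).trans
    (Finset.single_le_sum (f := fun a => |u (a, ω)|) (fun _ _ => abs_nonneg _) (Finset.mem_univ a))

lemma ct_bdd {μ₀ : Ω → ℝ} (hμ : IsPrior μ₀) (uS uR : A × Ω → ℝ) :
    BddAbove {x | ∃ (σ : Ω → M → ℝ) (ρ : M → A → ℝ), CTEq μ₀ uS uR σ ρ ∧ x = U μ₀ uS σ ρ} := by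
  refine ⟨∑ ω, μ₀ ω * ∑ a, |uS (a, ω)|, ?_⟩
  rintro _ ⟨σ, ρ, h, rfl⟩
  exact U_le_of_le hμ h.1 h.2.1 (le_sum_abs uS)

lemma pers_bdd {μ₀ : Ω → ℝ} (hμ : IsPrior μ₀) (uS uR : A × Ω → ℝ) :
    BddAbove {x | ∃ (σ : Ω → M → ℝ) (ρ : M → A → ℝ), PersProfile μ₀ uR σ ρ ∧ x = U μ₀ uS σ ρ} := by
  refine ⟨∑ ω, μ₀ ω * ∑ a, |uS (a, ω)|, ?_⟩
  rintro _ ⟨σ, ρ, h, rfl⟩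
  exact U_le_of_le hμ h.1 h.2.1 (le_sum_abs uS)

/-- The babbling equilibrium. -/
lemma exists_CTEq [Nonempty A] [Nonempty M] {μ₀ : Ω → ℝ} (hμ : IsPrior μ₀)
    (uS uR : A × Ω → ℝ) :
    ∃ (σ : Ω → M → ℝ) (ρ : M → A → ℝ), CTEq μ₀ uS uR σ ρ := by
  classical
  obtain ⟨m0⟩ := ‹Nonempty M›
  obtain ⟨a0, ha0⟩ := Finite.exists_max (fun a : A => ∑ ω, μ₀ ω * uR (a, ω))
  let σ : Ω → M → ℝ := fun _ m => if m = m0 then 1 else 0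
  let ρ : M → A → ℝ := fun _ a => if a = a0 then 1 else 0
  have hσ : IsMsg σ := fun ω => ⟨fun m => by simp only [σ]; split_ifs <;> norm_num, by simp [σ]⟩
  have hρ : IsAct ρ := fun ω => ⟨fun m => by simp only [ρ]; split_ifs <;> norm_num, by simp [ρ]⟩
  have hU : ∀ (u : A × Ω → ℝ) (σ' : Ω → M → ℝ), IsMsg σ' →
      U μ₀ u σ' ρ = ∑ ω, μ₀ ω * u (a0, ω) := by
    intro u σ' hσ'
    unfold U
    refine Finset.sum_congr rfl fun ω _ => ?_
    simp only [ρ, mul_ite, ite_mul, mul_one, mul_zero, zero_mul, Finset.sum_ite_eq',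
      Finset.mem_univ, if_true]
    rw [← Finset.sum_mul, ← Finset.mul_sum, (hσ' ω).2, mul_one]
  refine ⟨σ, ρ, hσ, hρ, fun σ' hσ' => ?_, fun ρ' hρ' => ?_⟩
  · rw [hU _ _ hσ, hU _ _ hσ']
  · rw [hU _ _ hσ]
    have : U μ₀ uR σ ρ' = ∑ a, ρ' m0 a * ∑ ω, μ₀ ω * uR (a, ω) := by
      unfold U
      simp only [Finset.mul_sum]
      rw [Finset.sum_comm (s := Finset.univ (α := A))]
      refine Finset.sum_congr rfl fun ω _ => ?_
      rw [Finset.sum_comm]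
      refine Finset.sum_congr rfl fun a _ => ?_
      simp only [σ, mul_ite, ite_mul, mul_one, mul_zero, zero_mul, Finset.sum_ite_eq',
        Finset.mem_univ, if_true]
      ring
    rw [this]
    calc _ ≤ ∑ a, ρ' m0 a * ∑ ω, μ₀ ω * uR (a0, ω) :=
          Finset.sum_le_sum fun a _ => mul_le_mul_of_nonneg_left (ha0 a) ((hρ' _).1 _)
      _ = _ := by rw [← Finset.sum_mul, (hρ' _).2, one_mul]

lemma continuous_U (μ₀ : Ω → ℝ) (u : A × Ω → ℝ) :
    Continuous fun z : (Ω → M → ℝ) × (M → A → ℝ) => U μ₀ u z.1 z.2 := by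
  unfold U; fun_prop

lemma isClosed_dist {X Z : Type} [Fintype X] [TopologicalSpace Z] {f : Z → X → ℝ}
    (hf : Continuous f) : IsClosed {z | IsDist (f z)} := by
  unfold IsDist
  have hf' : ∀ x, Continuous fun z => f z x := fun x => (continuous_apply x).comp hf
  simp only [Set.setOf_and]
  refine IsClosed.inter ?_ ?_
  · simp only [Set.setOf_forall]
    exact isClosed_iInter fun x => isClosed_le continuous_const (hf' x)
  · exact isClosed_eq (continuous_finsetSum _ fun x _ => hf' x) continuous_const

lemma IsDist.le_one {X : Type} [Fintype X] {f : X → ℝ} (h : IsDist f) (x : X) : f x ≤ 1 := by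
  rw [← h.2]
  exact Finset.single_le_sum (f := f) (fun y _ => h.1 y) (Finset.mem_univ x)

lemma isClosed_SBR (μ₀ : Ω → ℝ) (u : A × Ω → ℝ) :
    IsClosed {z : (Ω → M → ℝ) × (M → A → ℝ) | SBR μ₀ u z.1 z.2} := by
  have : {z : (Ω → M → ℝ) × (M → A → ℝ) | SBR μ₀ u z.1 z.2} =
      ⋂ (σ' : Ω → M → ℝ) (_ : IsMsg σ'),
        {z : (Ω → M → ℝ) × (M → A → ℝ) | U μ₀ u σ' z.2 ≤ U μ₀ u z.1 z.2} := by
    ext z; simp [SBR]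
  rw [this]
  refine isClosed_iInter fun σ' => isClosed_iInter fun _ => isClosed_le ?_ (continuous_U μ₀ u)
  unfold U; fun_prop

lemma isClosed_RBR (μ₀ : Ω → ℝ) (u : A × Ω → ℝ) :
    IsClosed {z : (Ω → M → ℝ) × (M → A → ℝ) | RBR μ₀ u z.1 z.2} := by
  have : {z : (Ω → M → ℝ) × (M → A → ℝ) | RBR μ₀ u z.1 z.2} =
      ⋂ (ρ' : M → A → ℝ) (_ : IsAct ρ'),
        {z : (Ω → M → ℝ) × (M → A → ℝ) | U μ₀ u z.1 ρ' ≤ U μ₀ u z.1 z.2} := by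
    ext z; simp [RBR]
  rw [this]
  refine isClosed_iInter fun σ' => isClosed_iInter fun _ => isClosed_le ?_ (continuous_U μ₀ u)
  unfold U; fun_prop

lemma isCompact_CTEq (μ₀ : Ω → ℝ) (uS uR : A × Ω → ℝ) :
    IsCompact {z : (Ω → M → ℝ) × (M → A → ℝ) | CTEq μ₀ uS uR z.1 z.2} := by
  have hc : IsClosed {z : (Ω → M → ℝ) × (M → A → ℝ) | CTEq μ₀ uS uR z.1 z.2} := by
    unfold CTEq
    refine IsClosed.and ?_ (IsClosed.and ?_ ((isClosed_SBR μ₀ uS).and (isClosed_RBR μ₀ uR)))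
    · unfold IsMsg
      simp only [Set.setOf_forall]
      exact isClosed_iInter fun ω => isClosed_dist (by fun_prop)
    · unfold IsAct
      simp only [Set.setOf_forall]
      exact isClosed_iInter fun ω => isClosed_dist (by fun_prop)
  refine IsCompact.of_isClosed_subset (isCompact_Icc (a := (0 : (Ω → M → ℝ) × (M → A → ℝ)))
    (b := (fun _ _ => 1, fun _ _ => 1))) hc ?_
  rintro ⟨σ, ρ⟩ ⟨hσ, hρ, -⟩
  exact ⟨⟨fun ω m => (hσ ω).1 m, fun m a => (hρ m).1 a⟩,
    ⟨fun ω m => (hσ ω).le_one m, fun m a => (hρ m).le_one a⟩⟩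

lemma exists_opt_CTEq [Nonempty A] [Nonempty M] {μ₀ : Ω → ℝ} (hμ : IsPrior μ₀)
    (uS uR : A × Ω → ℝ) :
    ∃ (σ : Ω → M → ℝ) (ρ : M → A → ℝ), CTEq μ₀ uS uR σ ρ ∧
      ctPayoff (M := M) μ₀ uS uR ≤ U μ₀ uS σ ρ := by
  obtain ⟨σ0, ρ0, h0⟩ := exists_CTEq (M := M) hμ uS uR
  obtain ⟨⟨σ1, ρ1⟩, hz, hmax⟩ := (isCompact_CTEq (M := M) μ₀ uS uR).exists_isMaxOn ⟨(σ0, ρ0), h0⟩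
    (continuous_U μ₀ uS).continuousOn
  refine ⟨σ1, ρ1, hz, csSup_le ⟨_, σ0, ρ0, h0, rfl⟩ ?_⟩
  rintro _ ⟨σ, ρ, h, rfl⟩
  exact isMaxOn_iff.1 hmax (σ, ρ) h

/-- Sender is never indifferent between two actions. -/
def NoTies (uS : A × Ω → ℝ) : Prop := ∀ ω a b, a ≠ b → uS (a, ω) ≠ uS (b, ω)

/-- Receiver is never indifferent after learning that the state is in a given set. -/
def NoRTies (μ₀ : Ω → ℝ) (uR : A × Ω → ℝ) : Prop :=
  ∀ S : Finset Ω, S.Nonempty → ∀ a b, a ≠ b → ∑ ω ∈ S, μ₀ ω * (uR (a, ω) - uR (b, ω)) ≠ 0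

/-- `x` is an optimal obedient outcome. -/
def IsOpt (μ₀ : Ω → ℝ) (uS uR x : A × Ω → ℝ) : Prop :=
  x ∈ Feas μ₀ uR ∧ ∀ y ∈ Feas μ₀ uR, ip y uS ≤ ip x uS

/-- Felicitous environments without ties: no value of commitment. -/
lemma noValue_of_felicitous [Nonempty A] {μ₀ : Ω → ℝ} (hμ : IsPrior μ₀) {uS uR : A × Ω → ℝ}
    (hM : Fintype.card A < Fintype.card M) (ht : NoTies uS) (hf : Felicitous μ₀ uS uR) :
    persPayoff (M := M) μ₀ uS uR ≤ ctPayoff (M := M) μ₀ uS uR := by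
  classical
  choose f hfm using fun ω => Finite.exists_max (fun a : A => uS (a, ω))
  have hid : ∀ a ω, ω ∈ idealStates uS a ↔ a = f ω := by
    intro a ω
    simp only [idealStates, Finset.mem_filter, Finset.mem_univ, true_and]
    constructor
    · intro h
      by_contra hne
      exact ht ω a (f ω) hne (le_antisymm (hfm ω a) (h _))
    · rintro rfl
      exact hfm ω
  let x : A × Ω → ℝ := fun p => if p.1 = f p.2 then μ₀ p.2 else 0
  have hx : x ∈ Feas μ₀ uR := by
    refine ⟨fun p => ?_, fun ω => by simp [x], fun a b => ?_⟩
    · simp only [x]; split_ifs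
      · exact (hμ.1 _).le
      · exact le_rfl
    · have := hf a b
      rw [← Finset.sum_filter_add_sum_filter_not Finset.univ (fun ω => a = f ω)]
      have e1 : (Finset.univ.filter fun ω => a = f ω) = idealStates uS a := by
        ext ω; simp [hid]
      rw [Finset.sum_eq_zero (s := Finset.univ.filter fun ω => ¬ a = f ω), add_zero, e1]
      · convert this using 1
        refine Finset.sum_congr rfl fun ω hω => ?_
        rw [hid] at hω
        simp [x, hω]
      · intro ω hω
        simp only [Finset.mem_filter, Finset.mem_univ, true_and] at hω
        simp [x, hω]
  obtain ⟨σ, ρ, hP, ho⟩ := exists_profile (M := M) hμ hM hx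
  have hU : U μ₀ uS σ ρ = ∑ ω, μ₀ ω * uS (f ω, ω) := by
    rw [U_eq, ho]
    simp [ip, x]
  have hS : CTEq μ₀ uS uR σ ρ := by
    refine ⟨hP.1, hP.2.1, fun σ' hσ' => ?_, hP.2.2⟩
    rw [hU]
    exact U_le_of_le hμ hσ' hP.2.1 (fun a ω => hfm ω a)
  calc persPayoff (M := M) μ₀ uS uR ≤ U μ₀ uS σ ρ := by
        refine csSup_le ⟨_, σ, ρ, hP, rfl⟩ ?_
        rintro _ ⟨σ', ρ', h, rfl⟩
        rw [hU]
        exact U_le_of_le hμ h.1 h.2.1 (fun a ω => hfm ω a)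
    _ ≤ _ := le_csSup (ct_bdd hμ uS uR) ⟨σ, ρ, hS, rfl⟩

/-- No mixing on path when the optimal outcome is unique. -/
lemma no_mixing {μ₀ : Ω → ℝ} (hμ : IsPrior μ₀) {uS uR : A × Ω → ℝ}
    {σ : Ω → M → ℝ} {ρ : M → A → ℝ} (hP : PersProfile μ₀ uR σ ρ)
    (hopt : IsOpt μ₀ uS uR (out μ₀ σ ρ))
    (huniq : ∀ x y, IsOpt μ₀ uS uR x → IsOpt μ₀ uS uR y → x = y)
    {m : M} {ω : Ω} (hm : 0 < σ ω m) {a b : A} (ha : 0 < ρ m a) (hb : 0 < ρ m b) : a = b := by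
  classical
  by_contra hab
  obtain ⟨hσ, hρ, hR⟩ := hP
  set s := min (ρ m a) (ρ m b) with hs
  have hs0 : 0 < s := lt_min ha hb
  let t : M → ℝ := fun m' => if m' = m then s else 0
  have ht0 : ∀ m', 0 ≤ t m' := fun m' => by
    simp only [t]; split_ifs
    · exact hs0.le
    · exact le_rfl
  have hta : ∀ m', t m' ≤ ρ m' a := fun m' => by
    simp only [t]; split_ifs with h
    · rw [h]; exact min_le_left _ _
    · exact (hρ _).1 _
  have htb : ∀ m', t m' ≤ ρ m' b := fun m' => by
    simp only [t]; split_ifs with h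
    · rw [h]; exact min_le_right _ _
    · exact (hρ _).1 _
  have h1 := devR_isAct hρ a b ht0 hta
  have h2 := devR_isAct hρ b a ht0 htb
  have hneg : ∀ u : A × Ω → ℝ, ∑ ω, (∑ m, μ₀ ω * σ ω m * t m) * (u (a, ω) - u (b, ω)) =
      - ∑ ω, (∑ m, μ₀ ω * σ ω m * t m) * (u (b, ω) - u (a, ω)) := by
    intro u
    rw [← Finset.sum_neg_distrib]
    exact Finset.sum_congr rfl fun ω _ => by ring
  have r1 := hR _ h1
  have r2 := hR _ h2
  have hzero : ∑ ω, (∑ m, μ₀ ω * σ ω m * t m) * (uR (b, ω) - uR (a, ω)) = 0 := by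
    rw [U_devR] at r1 r2
    rw [hneg] at r2
    linarith
  have R1 : PersProfile μ₀ uR σ (devR ρ a b t) := by
    refine ⟨hσ, h1, fun ρ' hρ' => ?_⟩
    rw [U_devR, hzero, add_zero]
    exact hR _ hρ'
  have R2 : PersProfile μ₀ uR σ (devR ρ b a t) := by
    refine ⟨hσ, h2, fun ρ' hρ' => ?_⟩
    rw [U_devR, hneg, hzero, neg_zero, add_zero]
    exact hR _ hρ'
  have f1 := out_mem_Feas hμ R1
  have f2 := out_mem_Feas hμ R2
  have s1 := hopt.2 _ f1
  have s2 := hopt.2 _ f2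
  have e1 : ip (out μ₀ σ (devR ρ a b t)) uS = ip (out μ₀ σ ρ) uS := by
    rw [← U_eq, ← U_eq, U_devR] at s1 s2 ⊢
    rw [hneg] at s2
    linarith
  have := huniq _ _ hopt ⟨f1, fun y hy => e1 ▸ hopt.2 y hy⟩
  have h3 := congrFun this (a, ω)
  rw [out_devR] at h3
  have hpos : 0 < ∑ m, μ₀ ω * σ ω m * t m := by
    refine Finset.sum_pos' (fun m' _ => mul_nonneg (mul_nonneg (hμ.1 _).le ((hσ _).1 _)) (ht0 _))
      ⟨m, Finset.mem_univ _, ?_⟩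
    simp only [t, if_true]
    exact mul_pos (mul_pos (hμ.1 _) hm) hs0
  simp only [hab, if_true, if_false] at h3
  linarith

lemma felicitous_of_noValue [Nonempty A] [Nonempty M] {μ₀ : Ω → ℝ} (hμ : IsPrior μ₀)
    {uS uR : A × Ω → ℝ} (hM : Fintype.card A < Fintype.card M) (ht : NoTies uS)
    (hr : NoRTies μ₀ uR) (hJ : JointlyInclusive uS uR)
    (huniq : ∀ x y, IsOpt μ₀ uS uR x → IsOpt μ₀ uS uR y → x = y)
    (hv : persPayoff (M := M) μ₀ uS uR ≤ ctPayoff (M := M) μ₀ uS uR) :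
    Felicitous μ₀ uS uR := by
  classical
  obtain ⟨σ, ρ, ⟨hσ, hρ, hS, hR⟩, hU⟩ := exists_opt_CTEq (M := M) hμ uS uR
  have hP : PersProfile μ₀ uR σ ρ := ⟨hσ, hρ, hR⟩
  have hopt : IsOpt μ₀ uS uR (out μ₀ σ ρ) := by
    refine ⟨out_mem_Feas hμ hP, fun y hy => ?_⟩
    obtain ⟨σ', ρ', hP', rfl⟩ := exists_profile (M := M) hμ hM hy
    rw [← U_eq, ← U_eq]
    exact (le_csSup (pers_bdd hμ uS uR) ⟨σ', ρ', hP', rfl⟩).trans (hv.trans hU)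
  have hpure : ∀ m ω a, 0 < σ ω m → 0 < ρ m a → ∀ u : A → ℝ, ∑ b, ρ m b * u b = u a := by
    intro m ω a h1 h2 u
    have hz : ∀ b, b ≠ a → ρ m b = 0 := fun b hb => by
      by_contra h
      exact hb (no_mixing hμ hP hopt huniq h1 (lt_of_le_of_ne ((hρ m).1 b) (Ne.symm h)) h2)
    have h1 : ρ m a = 1 := by
      rw [← (hρ m).2, Finset.sum_eq_single a]
      · intro b _ hb; exact hz b hb
      · simp
    rw [Finset.sum_eq_single a, h1, one_mul]
    · intro b _ hb; rw [hz b hb, zero_mul]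
    · simp
  have hex : ∀ a ω, 0 < out μ₀ σ ρ (a, ω) → ∃ m, 0 < σ ω m ∧ 0 < ρ m a := by
    intro a ω h
    obtain ⟨m, -, hm⟩ := Finset.exists_ne_zero_of_sum_ne_zero h.ne'
    refine ⟨m, lt_of_le_of_ne ((hσ _).1 _) fun h0 => hm ?_,
      lt_of_le_of_ne ((hρ _).1 _) fun h0 => hm ?_⟩
    · simp [← h0]
    · simp [← h0]
  -- best available action in each state
  have hbest : ∀ a a' ω ω', 0 < out μ₀ σ ρ (a, ω) → 0 < out μ₀ σ ρ (a', ω') →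
      uS (a', ω) ≤ uS (a, ω) := by
    intro a a' ω ω' h h'
    obtain ⟨m, h1, h2⟩ := hex a ω h
    obtain ⟨m', h1', h2'⟩ := hex a' ω' h'
    have := hS _ (devS_isMsg hσ ω m m')
    rw [U_devS, hpure m ω a h1 h2 (fun b => uS (b, ω)),
      hpure m' ω' a' h1' h2' (fun b => uS (b, ω))] at this
    have hp : 0 < μ₀ ω * σ ω m := mul_pos (hμ.1 _) h1
    by_contra hc
    push Not at hc
    have := mul_pos hp (sub_pos.2 hc)
    linarith
  obtain ⟨ho0, ho1, ho2⟩ := hopt.1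
  have hα : ∀ ω, ∃ a, 0 < out μ₀ σ ρ (a, ω) := by
    intro ω
    by_contra hc
    push Not at hc
    have := ho1 ω
    rw [Finset.sum_eq_zero fun a _ => le_antisymm (hc a) (ho0 _)] at this
    exact (hμ.1 ω).ne this
  choose α hα using hα
  have hαu : ∀ a ω, 0 < out μ₀ σ ρ (a, ω) → a = α ω := by
    intro a ω h
    by_contra hne
    exact ht ω _ _ hne (le_antisymm (hbest _ _ _ _ (hα ω) h) (hbest _ _ _ _ h (hα ω)))
  have hz : ∀ a ω, a ≠ α ω → out μ₀ σ ρ (a, ω) = 0 := fun a ω h => by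
    by_contra h0
    exact h (hαu a ω (lt_of_le_of_ne (ho0 _) (Ne.symm h0)))
  have hout : ∀ a ω, out μ₀ σ ρ (a, ω) = if a = α ω then μ₀ ω else 0 := by
    intro a ω
    split_ifs with h
    · subst h
      rw [← ho1 ω, Finset.sum_eq_single (α ω)]
      · intro b _ hb; exact hz b ω hb
      · simp
    · exact hz a ω h
  have hsum : ∀ a b, ∑ ω, out μ₀ σ ρ (a, ω) * (uR (a, ω) - uR (b, ω)) =
      ∑ ω ∈ Finset.univ.filter (fun ω => a = α ω), μ₀ ω * (uR (a, ω) - uR (b, ω)) := by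
    intro a b
    rw [Finset.sum_filter]
    refine Finset.sum_congr rfl fun ω _ => ?_
    rw [hout, ite_mul, zero_mul]
  -- every action is used
  have hall : ∀ a, ∃ ω, α ω = a := by
    intro a
    obtain ⟨w, hwS, hwR⟩ := hJ a
    refine ⟨w, ?_⟩
    by_contra hne
    set c := α w with hc
    have hgap : ∀ b, b ≠ c → 0 < ∑ ω, out μ₀ σ ρ (c, ω) * (uR (c, ω) - uR (b, ω)) := by
      intro b hb
      refine lt_of_le_of_ne (ho2 c b) ?_
      rw [hsum]
      exact (hr _ ⟨w, by simp [hc]⟩ c b (Ne.symm hb)).symm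
    have hev : ∀ᶠ δ : ℝ in nhdsWithin 0 (Set.Ioi 0), ∀ b, 0 ≤
        ∑ ω, out μ₀ σ ρ (c, ω) * (uR (c, ω) - uR (b, ω)) - δ * (uR (c, w) - uR (b, w)) := by
      rw [Filter.eventually_all]
      intro b
      by_cases hb : b = c
      · subst hb; simp
      · have hcont : Filter.Tendsto (fun δ : ℝ =>
            ∑ ω, out μ₀ σ ρ (c, ω) * (uR (c, ω) - uR (b, ω)) - δ * (uR (c, w) - uR (b, w)))
            (nhdsWithin 0 (Set.Ioi 0))
            (nhds (∑ ω, out μ₀ σ ρ (c, ω) * (uR (c, ω) - uR (b, ω))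
              - 0 * (uR (c, w) - uR (b, w)))) :=
          (Continuous.tendsto (by fun_prop) 0).mono_left nhdsWithin_le_nhds
        have := hcont.eventually (lt_mem_nhds (a := 0) (by simpa using hgap b hb))
        exact this.mono fun _ h => h.le
    have hev2 : ∀ᶠ δ : ℝ in nhdsWithin 0 (Set.Ioi 0), δ < μ₀ w :=
      nhdsWithin_le_nhds (Iio_mem_nhds (hμ.1 w))
    have hev3 : ∀ᶠ δ : ℝ in nhdsWithin 0 (Set.Ioi 0), 0 < δ := self_mem_nhdsWithin
    obtain ⟨δ, hδ1, hδ2, hδ3⟩ := (hev.and (hev2.and hev3)).exists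
    let v : Ω → ℝ := fun ω => if ω = w then δ else 0
    let y : A × Ω → ℝ := fun p => out μ₀ σ ρ p +
      v p.2 * ((if p.1 = a then 1 else 0) - (if p.1 = c then 1 else 0))
    have hysum : ∀ d b, ∑ ω, y (d, ω) * (uR (d, ω) - uR (b, ω)) =
        ∑ ω, out μ₀ σ ρ (d, ω) * (uR (d, ω) - uR (b, ω)) +
        δ * ((if d = a then 1 else 0) - (if d = c then 1 else 0)) * (uR (d, w) - uR (b, w)) := by
      intro d b
      simp only [y, v, add_mul, Finset.sum_add_distrib]
      congr 1
      simp
    have hy : y ∈ Feas μ₀ uR := by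
      refine ⟨fun ⟨d, ω⟩ => ?_, fun ω => ?_, fun d b => ?_⟩
      · simp only [y, v]
        have h0 := ho0 (d, ω)
        by_cases h1 : ω = w
        · subst h1
          by_cases h2 : d = c
          · have h3 : out μ₀ σ ρ (d, ω) = μ₀ ω := by rw [hout, if_pos (h2.trans hc)]
            have h4 : d ≠ a := fun h => hne (h2.symm.trans h)
            rw [h3, if_neg h4, if_pos h2, if_pos rfl]; linarith
          · rw [if_neg h2, if_pos rfl]
            split_ifs <;> linarith
        · simpa [h1] using h0
      · simp only [y, Finset.sum_add_distrib, ← Finset.mul_sum, Finset.sum_sub_distrib]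
        rw [ho1]; simp
      · rw [hysum]
        have h0 := ho2 d b
        by_cases h1 : d = c
        · have h4 : d ≠ a := fun h => hne (h1.symm.trans h)
          have := hδ1 b
          rw [if_neg h4, if_pos h1]
          rw [← h1] at this
          linarith
        · by_cases h2 : d = a
          · rw [if_pos h2, if_neg h1]
            have : 0 ≤ uR (d, w) - uR (b, w) := by
              by_cases h3 : b = d
              · rw [h3]; simp
              · rw [h2] at h3 ⊢
                exact (sub_pos.2 (hwR b h3)).le
            have := mul_nonneg hδ3.le this
            linarith
          · rw [if_neg h1, if_neg h2]; simpa using h0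
    have h1 := hopt.2 y hy
    simp only [y] at h1
    rw [ip_add_ind] at h1
    have h2 : ∑ ω, v ω * (uS (a, ω) - uS (c, ω)) = δ * (uS (a, w) - uS (c, w)) := by
      simp [v]
    rw [h2] at h1
    have h3 := mul_pos hδ3 (sub_pos.2 (hwS c hne))
    linarith
  have hideal : ∀ a ω, ω ∈ idealStates uS a ↔ a = α ω := by
    intro a ω
    simp only [idealStates, Finset.mem_filter, Finset.mem_univ, true_and]
    have hb : ∀ b, uS (b, ω) ≤ uS (α ω, ω) := by
      intro b
      obtain ⟨ω', rfl⟩ := hall b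
      exact hbest _ _ _ _ (hα ω) (hα ω')
    constructor
    · intro h
      by_contra hne
      exact ht ω _ _ hne (le_antisymm (hb a) (h _))
    · rintro rfl
      exact hb
  intro a b
  have := ho2 a b
  rw [hsum] at this
  convert this using 2
  ext ω
  simp [hideal]

/-! ### Generic uniqueness of the optimal outcome -/

lemma ip_add (x u v : A × Ω → ℝ) : ip x (u + v) = ip x u + ip x v := by
  simp [ip, mul_add, Finset.sum_add_distrib]

lemma ip_smul (x u : A × Ω → ℝ) (c : ℝ) : ip x (c • u) = c * ip x u := by
  simp only [ip, Finset.mul_sum, Pi.smul_apply, smul_eq_mul]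
  exact Finset.sum_congr rfl fun ω _ => Finset.sum_congr rfl fun a _ => by ring

/-- `ip` as a linear map. -/
noncomputable def ipL (x : A × Ω → ℝ) : (A × Ω → ℝ) →L[ℝ] ℝ :=
  LinearMap.toContinuousLinearMap
    { toFun := fun u => ip x u
      map_add' := ip_add x
      map_smul' := fun c u => by simpa using ip_smul x u c }

lemma ipL_apply (x u : A × Ω → ℝ) : ipL x u = ip x u := rfl

lemma eq_of_ip {x y : A × Ω → ℝ} (h : ∀ u, ip x u = ip y u) : x = y := by
  classical
  have key : ∀ (x : A × Ω → ℝ) (p : A × Ω), ip x (Pi.single p 1) = x p := by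
    rintro x ⟨a, ω⟩
    unfold ip
    rw [Finset.sum_eq_single ω, Finset.sum_eq_single a]
    · simp
    · intro b _ hb
      simp [Pi.single_apply, hb]
    · simp
    · intro b _ hb
      refine Finset.sum_eq_zero fun c _ => ?_
      simp [Pi.single_apply, hb]
    · simp
  funext p
  rw [← key x p, ← key y p, h]

lemma Feas_nonempty [Nonempty A] {μ₀ : Ω → ℝ} (hμ : IsPrior μ₀) (uR : A × Ω → ℝ) :
    (Feas μ₀ uR).Nonempty := by
  classical
  choose f hfm using fun ω => Finite.exists_max (fun a : A => uR (a, ω))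
  refine ⟨fun p => if p.1 = f p.2 then μ₀ p.2 else 0, fun p => ?_, fun ω => by simp, fun a b => ?_⟩
  · dsimp only
    split_ifs
    · exact (hμ.1 _).le
    · exact le_rfl
  · refine Finset.sum_nonneg fun ω _ => ?_
    dsimp only
    split_ifs with h
    · refine mul_nonneg (hμ.1 _).le ?_
      rw [h]
      exact sub_nonneg.2 (hfm ω b)
    · simp

/-- The value function. -/
noncomputable def V (μ₀ : Ω → ℝ) (uR uS : A × Ω → ℝ) : ℝ :=
  sSup (Set.image (fun x => ip x uS) (Feas μ₀ uR))

lemma V_bdd {μ₀ : Ω → ℝ} (uR uS : A × Ω → ℝ) :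
    BddAbove (Set.image (fun x => ip x uS) (Feas μ₀ uR)) := by
  refine ⟨∑ ω, μ₀ ω * ∑ a, |uS (a, ω)|, ?_⟩
  rintro _ ⟨x, hx, rfl⟩
  exact ip_le_of_le hx.1 hx.2.1 (le_sum_abs uS)

lemma ip_le_V {μ₀ : Ω → ℝ} {uR : A × Ω → ℝ} {x : A × Ω → ℝ} (hx : x ∈ Feas μ₀ uR)
    (uS : A × Ω → ℝ) : ip x uS ≤ V μ₀ uR uS :=
  le_csSup (V_bdd uR uS) ⟨x, hx, rfl⟩

lemma V_lipschitz [Nonempty A] {μ₀ : Ω → ℝ} (hμ : IsPrior μ₀) (uR : A × Ω → ℝ) :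
    LipschitzWith 1 (V μ₀ uR) := by
  refine LipschitzWith.of_le_add_mul 1 fun u v => ?_
  refine csSup_le ((Feas_nonempty hμ uR).image _) ?_
  rintro _ ⟨x, hx, rfl⟩
  have h1 : ip x u = ip x v + ip x (u - v) := by rw [← ip_add]; congr 1; abel
  have h2 : ip x (u - v) ≤ ∑ ω, μ₀ ω * dist u v := by
    refine ip_le_of_le hx.1 hx.2.1 fun a ω => ?_
    calc (u - v) (a, ω) ≤ |u (a, ω) - v (a, ω)| := le_abs_self _
      _ = dist (u (a, ω)) (v (a, ω)) := (Real.dist_eq _ _).symm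
      _ ≤ dist u v := dist_le_pi_dist u v (a, ω)
  rw [← Finset.sum_mul, hμ.2] at h2
  have h3 := ip_le_V hx v
  simp only [NNReal.coe_one]
  linarith

/-- The optimal outcome is not unique. -/
def NonUniq (μ₀ : Ω → ℝ) (uS uR : A × Ω → ℝ) : Prop :=
  ∃ x y, IsOpt μ₀ uS uR x ∧ IsOpt μ₀ uS uR y ∧ x ≠ y

lemma fiber_null [Nonempty A] {μ₀ : Ω → ℝ} (hμ : IsPrior μ₀) (uR : A × Ω → ℝ) :
    volume {uS : A × Ω → ℝ | NonUniq μ₀ uS uR} = 0 := by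
  have h := (V_lipschitz hμ uR).ae_differentiableAt (μ := (volume : Measure (A × Ω → ℝ)))
  refine measure_mono_null ?_ (ae_iff.1 h)
  rintro u ⟨x, y, hx, hy, hne⟩ hd
  apply hne
  have key : ∀ z, IsOpt μ₀ u uR z → fderiv ℝ (V μ₀ uR) u = ipL z := by
    intro z hz
    have hVu : V μ₀ uR u = ip z u := by
      refine le_antisymm (csSup_le ((Feas_nonempty hμ uR).image _) ?_) (ip_le_V hz.1 u)
      rintro _ ⟨w, hw, rfl⟩
      exact hz.2 w hw
    have hmin : IsLocalMin (fun v => V μ₀ uR v - ipL z v) u := by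
      refine Filter.Eventually.of_forall fun v => ?_
      have := ip_le_V hz.1 v
      simp only [ipL_apply, hVu, sub_self]
      linarith
    have := hmin.hasFDerivAt_eq_zero (hd.hasFDerivAt.sub (ipL z).hasFDerivAt)
    exact sub_eq_zero.1 this
  have hxy : ipL x = ipL y := (key x hx).symm.trans (key y hy)
  exact eq_of_ip fun v => by rw [← ipL_apply, hxy, ipL_apply]

lemma isClosed_proj {X Y : Type} [TopologicalSpace X] [TopologicalSpace Y] {K : Set X}
    (hK : IsCompact K) {C : Set (X × Y)} (hC : IsClosed C) :
    IsClosed {y | ∃ x ∈ K, (x, y) ∈ C} := by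
  have : CompactSpace K := isCompact_iff_compactSpace.1 hK
  have h := isClosedMap_snd_of_compactSpace (X := K) (Y := Y)
    ((fun z : K × Y => ((z.1 : X), z.2)) ⁻¹' C) (hC.preimage (by fun_prop))
  convert h using 1
  ext y
  simp

/-- A compact box that contains all outcomes. -/
def box (Ω A : Type) : Set (A × Ω → ℝ) := Set.Icc 0 1

lemma isCompact_box : IsCompact (box Ω A) := isCompact_Icc

lemma Feas_sub_box {μ₀ : Ω → ℝ} (hμ : IsPrior μ₀) (uR : A × Ω → ℝ) :
    Feas μ₀ uR ⊆ box Ω A := by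
  rintro x ⟨h0, h1, -⟩
  refine ⟨fun p => h0 p, fun ⟨a, ω⟩ => ?_⟩
  have e1 : x (a, ω) ≤ μ₀ ω := by
    rw [← h1 ω]
    exact Finset.single_le_sum (f := fun a => x (a, ω)) (fun b _ => h0 _) (Finset.mem_univ a)
  have e2 : μ₀ ω ≤ 1 := by
    rw [← hμ.2]
    exact Finset.single_le_sum (f := μ₀) (fun b _ => (hμ.1 _).le) (Finset.mem_univ ω)
  exact e1.trans e2

lemma continuous_ip : Continuous fun z : (A × Ω → ℝ) × (A × Ω → ℝ) => ip z.1 z.2 := by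
  unfold ip; fun_prop

lemma isClosed_Feas {Z : Type} [TopologicalSpace Z] (μ₀ : Ω → ℝ) {f g : Z → (A × Ω → ℝ)}
    (hf : Continuous f) (hg : Continuous g) : IsClosed {z | f z ∈ Feas μ₀ (g z)} := by
  have hf' : ∀ p, Continuous fun z => f z p := fun p => (continuous_apply p).comp hf
  have hg' : ∀ p, Continuous fun z => g z p := fun p => (continuous_apply p).comp hg
  unfold Feas
  simp only [Set.mem_setOf_eq]
  refine IsClosed.and ?_ (IsClosed.and ?_ ?_)
  · simp only [Set.setOf_forall]
    exact isClosed_iInter fun p => isClosed_le continuous_const (hf' p)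
  · simp only [Set.setOf_forall]
    exact isClosed_iInter fun p =>
      isClosed_eq (continuous_finsetSum _ fun a _ => hf' _) continuous_const
  · simp only [Set.setOf_forall]
    refine isClosed_iInter fun a => isClosed_iInter fun b => isClosed_le continuous_const ?_
    exact continuous_finsetSum _ fun ω _ => (hf' _).mul ((hg' _).sub (hg' _))

lemma isCompact_Feas {μ₀ : Ω → ℝ} (hμ : IsPrior μ₀) (uR : A × Ω → ℝ) :
    IsCompact (Feas μ₀ uR) :=
  isCompact_box.of_isClosed_subset (isClosed_Feas μ₀ continuous_id continuous_const)
    (Feas_sub_box hμ uR)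

/-- Environments with two far-apart obedient outcomes of total value at least `q`. -/
def B1 (μ₀ : Ω → ℝ) (n : ℕ) (q : ℝ) : Set ((A × Ω → ℝ) × (A × Ω → ℝ)) :=
  {e | ∃ z ∈ box Ω A ×ˢ box Ω A, (z, e) ∈ {w : ((A × Ω → ℝ) × (A × Ω → ℝ)) ×
      ((A × Ω → ℝ) × (A × Ω → ℝ)) | w.1.1 ∈ Feas μ₀ w.2.2 ∧ w.1.2 ∈ Feas μ₀ w.2.2 ∧
      1 / ((n : ℝ) + 1) ≤ dist w.1.1 w.1.2 ∧ q ≤ ip w.1.1 w.2.1 + ip w.1.2 w.2.1}}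

/-- Environments with an obedient outcome of value at least `q / 2`. -/
def B2 (μ₀ : Ω → ℝ) (q : ℝ) : Set ((A × Ω → ℝ) × (A × Ω → ℝ)) :=
  {e | ∃ z ∈ box Ω A, (z, e) ∈ {w : (A × Ω → ℝ) ×
      ((A × Ω → ℝ) × (A × Ω → ℝ)) | w.1 ∈ Feas μ₀ w.2.2 ∧ q ≤ 2 * ip w.1 w.2.1}}

lemma isClosed_B1 (μ₀ : Ω → ℝ) (n : ℕ) (q : ℝ) : IsClosed (B1 (A := A) μ₀ n q) := by
  refine isClosed_proj (isCompact_box.prod isCompact_box) ?_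
  refine IsClosed.and (isClosed_Feas μ₀ (by fun_prop) (by fun_prop))
    (IsClosed.and (isClosed_Feas μ₀ (by fun_prop) (by fun_prop)) (IsClosed.and ?_ ?_))
  · exact isClosed_le continuous_const (by fun_prop)
  · refine isClosed_le continuous_const (Continuous.add ?_ ?_)
    · exact continuous_ip.comp (by fun_prop : Continuous fun w : ((A × Ω → ℝ) × (A × Ω → ℝ)) ×
        ((A × Ω → ℝ) × (A × Ω → ℝ)) => (w.1.1, w.2.1))
    · exact continuous_ip.comp (by fun_prop : Continuous fun w : ((A × Ω → ℝ) × (A × Ω → ℝ)) ×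
        ((A × Ω → ℝ) × (A × Ω → ℝ)) => (w.1.2, w.2.1))

lemma isClosed_B2 (μ₀ : Ω → ℝ) (q : ℝ) : IsClosed (B2 (A := A) μ₀ q) := by
  refine isClosed_proj isCompact_box ?_
  refine IsClosed.and (isClosed_Feas μ₀ (by fun_prop) (by fun_prop)) ?_
  refine isClosed_le continuous_const (continuous_const.mul ?_)
  exact continuous_ip.comp (by fun_prop : Continuous fun w : (A × Ω → ℝ) ×
        ((A × Ω → ℝ) × (A × Ω → ℝ)) => (w.1, w.2.1))

lemma nonUniq_eq [Nonempty A] {μ₀ : Ω → ℝ} (hμ : IsPrior μ₀) :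
    {e : (A × Ω → ℝ) × (A × Ω → ℝ) | NonUniq μ₀ e.1 e.2} =
      ⋃ n : ℕ, ⋂ q : ℚ, (B1 μ₀ n (q : ℝ) ∪ (B2 μ₀ (q : ℝ))ᶜ) := by
  ext ⟨uS, uR⟩
  simp only [Set.mem_setOf_eq, Set.mem_iUnion, Set.mem_iInter, Set.mem_union, Set.mem_compl_iff]
  constructor
  · rintro ⟨x, y, hx, hy, hne⟩
    obtain ⟨n, hn⟩ := exists_nat_one_div_lt (dist_pos.2 hne)
    refine ⟨n, fun q => ?_⟩
    by_cases hq : (q : ℝ) ≤ ip x uS + ip y uS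
    · exact Or.inl ⟨(x, y), ⟨Feas_sub_box hμ _ hx.1, Feas_sub_box hμ _ hy.1⟩,
        hx.1, hy.1, hn.le, hq⟩
    · right
      rintro ⟨z, -, hz, hz2⟩
      have h1 := hx.2 z hz
      have h2 := hy.2 z hz
      simp only at hz2
      linarith
  · rintro ⟨n, hn⟩
    have hc : ∀ u, Continuous fun x : A × Ω → ℝ => ip x u := fun u =>
      continuous_ip.comp (by fun_prop : Continuous fun x : A × Ω → ℝ => (x, u))
    obtain ⟨x0, hx0, hmax⟩ := (isCompact_Feas hμ uR).exists_isMaxOn (Feas_nonempty hμ uR)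
      (hc uS).continuousOn
    rw [isMaxOn_iff] at hmax
    have hB2 : ∀ q : ℝ, q ≤ 2 * ip x0 uS → (uS, uR) ∈ B2 μ₀ q := fun q hq =>
      ⟨x0, Feas_sub_box hμ _ hx0, hx0, hq⟩
    let P : Set ((A × Ω → ℝ) × (A × Ω → ℝ)) :=
      (Feas μ₀ uR ×ˢ Feas μ₀ uR) ∩ {z | 1 / ((n : ℝ) + 1) ≤ dist z.1 z.2}
    have hPc : IsCompact P := ((isCompact_Feas hμ uR).prod (isCompact_Feas hμ uR)).inter_right
      (isClosed_le continuous_const (by fun_prop))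
    have hPn : P.Nonempty := by
      obtain ⟨q, hq⟩ := exists_rat_lt (2 * ip x0 uS)
      rcases hn q with h | h
      · obtain ⟨z, -, h1, h2, h3, -⟩ := h
        exact ⟨z, ⟨h1, h2⟩, h3⟩
      · exact absurd (hB2 _ hq.le) h
    obtain ⟨⟨x, y⟩, ⟨⟨hx, hy⟩, hd⟩, hm⟩ := hPc.exists_isMaxOn hPn
      (f := fun z => ip z.1 uS + ip z.2 uS)
      (((hc uS).comp continuous_fst).add ((hc uS).comp continuous_snd)).continuousOn
    rw [isMaxOn_iff] at hm
    have hge : 2 * ip x0 uS ≤ ip x uS + ip y uS := by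
      by_contra hlt
      push Not at hlt
      obtain ⟨q, hq1, hq2⟩ := exists_rat_btwn hlt
      rcases hn q with h | h
      · obtain ⟨z, -, h1, h2, h3, h4⟩ := h
        have := hm z ⟨⟨h1, h2⟩, h3⟩
        simp only at h4 this
        linarith
      · exact absurd (hB2 _ hq2.le) h
    have h1 := hmax x hx
    have h2 := hmax y hy
    refine ⟨x, y, ⟨hx, fun z hz => ?_⟩, ⟨hy, fun z hz => ?_⟩, ?_⟩
    · have := hmax z hz
      linarith
    · have := hmax z hz
      linarith
    · rintro rfl
      simp only [Set.mem_setOf_eq, dist_self] at hd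
      have : (0 : ℝ) < 1 / ((n : ℝ) + 1) := Nat.one_div_pos_of_nat
      linarith

lemma nonUniq_null [Nonempty A] {μ₀ : Ω → ℝ} (hμ : IsPrior μ₀) :
    volume {e : (A × Ω → ℝ) × (A × Ω → ℝ) | NonUniq μ₀ e.1 e.2} = 0 := by
  have hm : MeasurableSet {e : (A × Ω → ℝ) × (A × Ω → ℝ) | NonUniq μ₀ e.1 e.2} := by
    rw [nonUniq_eq hμ]
    exact MeasurableSet.iUnion fun n => MeasurableSet.iInter fun q =>
      (isClosed_B1 μ₀ n q).measurableSet.union (isClosed_B2 μ₀ q).measurableSet.compl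
  rw [Measure.volume_eq_prod, Measure.prod_apply_symm hm]
  simp only [Set.preimage_setOf_eq, fiber_null hμ, lintegral_zero]

lemma ker_null (L : ((A × Ω → ℝ) × (A × Ω → ℝ)) →ₗ[ℝ] ℝ) {v} (hv : L v ≠ 0) :
    volume {e | L e = 0} = 0 := by
  have hH : (volume : Measure ((A × Ω → ℝ) × (A × Ω → ℝ))).IsAddHaarMeasure := by
    exact Measure.prod.instIsAddHaarMeasure volume volume
  have := Measure.addHaar_submodule
    (volume : Measure ((A × Ω → ℝ) × (A × Ω → ℝ))) (LinearMap.ker L) (by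
      intro h
      apply hv
      have : v ∈ LinearMap.ker L := h ▸ Submodule.mem_top
      exact this)
  exact this

lemma noTies_null : volume {e : (A × Ω → ℝ) × (A × Ω → ℝ) | ¬ NoTies e.1} = 0 := by
  classical
  have : {e : (A × Ω → ℝ) × (A × Ω → ℝ) | ¬ NoTies e.1} ⊆
      ⋃ (ω : Ω) (a : A) (b : A) (_ : a ≠ b), {e | e.1 (a, ω) - e.1 (b, ω) = 0} := by
    intro e he
    simp only [NoTies, Set.mem_setOf_eq] at he
    push Not at he
    obtain ⟨ω, a, b, hab, h⟩ := he
    simp only [Set.mem_iUnion]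
    exact ⟨ω, a, b, hab, sub_eq_zero.2 h⟩
  refine measure_mono_null this ?_
  refine measure_iUnion_null fun ω => measure_iUnion_null fun a => measure_iUnion_null fun b =>
    measure_iUnion_null fun hab => ?_
  refine ker_null ((LinearMap.proj (R := ℝ) (φ := fun _ : A × Ω => ℝ) (a, ω)
    - LinearMap.proj (b, ω)) ∘ₗ LinearMap.fst ℝ _ _)
    (v := (Pi.single (a, ω) 1, 0)) ?_
  simp [Pi.single_apply, hab.symm]

lemma noRTies_null {μ₀ : Ω → ℝ} (hμ : IsPrior μ₀) :
    volume {e : (A × Ω → ℝ) × (A × Ω → ℝ) | ¬ NoRTies μ₀ e.2} = 0 := by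
  classical
  have : {e : (A × Ω → ℝ) × (A × Ω → ℝ) | ¬ NoRTies μ₀ e.2} ⊆
      ⋃ (S : Finset Ω) (_ : S.Nonempty) (a : A) (b : A) (_ : a ≠ b),
        {e | ∑ ω ∈ S, μ₀ ω * (e.2 (a, ω) - e.2 (b, ω)) = 0} := by
    intro e he
    simp only [NoRTies, Set.mem_setOf_eq] at he
    push Not at he
    obtain ⟨S, hS, a, b, hab, h⟩ := he
    simp only [Set.mem_iUnion]
    exact ⟨S, hS, a, b, hab, h⟩
  refine measure_mono_null this ?_
  refine measure_iUnion_null fun S => measure_iUnion_null fun hS => measure_iUnion_null fun a =>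
    measure_iUnion_null fun b => measure_iUnion_null fun hab => ?_
  obtain ⟨w, hw⟩ := hS
  have h := ker_null ((∑ ω ∈ S, μ₀ ω • (LinearMap.proj (R := ℝ) (φ := fun _ : A × Ω => ℝ) (a, ω)
    - LinearMap.proj (b, ω))) ∘ₗ LinearMap.snd ℝ _ _)
    (v := ((0 : A × Ω → ℝ), Pi.single (a, w) 1)) (by
      simp [Pi.single_apply, hab.symm, hw, (hμ.1 w).ne'])
  convert h using 4
  simp

/-! ### Jointly inclusive environments -/

lemma mp_uncurry : MeasurePreserving
    (fun (f : Ω → A → ℝ) (p : A × Ω) => f p.2 p.1) volume volume := by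
  have hm : Measurable (fun (f : Ω → A → ℝ) (p : A × Ω) => f p.2 p.1) := by fun_prop
  refine ⟨hm, ?_⟩
  refine (Measure.pi_eq fun s hs => ?_).symm
  rw [Measure.map_apply hm (MeasurableSet.univ_pi hs)]
  have : (fun (f : Ω → A → ℝ) (p : A × Ω) => f p.2 p.1) ⁻¹' (Set.univ.pi s) =
      Set.univ.pi fun ω => Set.univ.pi fun a => s (a, ω) := by
    ext f
    simp only [Set.mem_preimage, Set.mem_univ_pi]
    exact ⟨fun h ω a => h (a, ω), fun h p => h p.2 p.1⟩
  rw [this, volume_pi_pi]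
  simp only [volume_pi_pi]
  rw [Fintype.prod_prod_type_right]

lemma mp_env : MeasurePreserving
    (fun (f : Ω → (A → ℝ) × (A → ℝ)) =>
      ((fun p : A × Ω => (f p.2).1 p.1), (fun p : A × Ω => (f p.2).2 p.1))) volume volume := by
  have h1 := volume_measurePreserving_arrowProdEquivProdArrow (A → ℝ) (A → ℝ) Ω
  have h2 := (mp_uncurry (Ω := Ω) (A := A)).prod (mp_uncurry (Ω := Ω) (A := A))
  exact h2.comp h1

/-- The unit cube of utilities in one state. -/
def Q1 (A : Type) : Set ((A → ℝ) × (A → ℝ)) :=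
  (Set.univ.pi fun _ => Set.Icc 0 1) ×ˢ (Set.univ.pi fun _ => Set.Icc 0 1)

open Classical in
/-- Utilities of one player that make `a` the unique ideal action. -/
noncomputable def E0 (a : A) : Set (A → ℝ) :=
  Set.univ.pi fun b => if b = a then Set.Ioc (1 / 2) 1 else Set.Icc 0 (1 / 2)

/-- Utilities in one state that make `a` the unique ideal action of both players. -/
noncomputable def E1 (a : A) : Set ((A → ℝ) × (A → ℝ)) := E0 a ×ˢ E0 a

lemma vol_Q1 : volume (Q1 A) = 1 := by
  unfold Q1
  rw [Measure.volume_eq_prod, Measure.prod_prod]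
  rw [volume_pi_pi]
  simp

lemma meas_Q1 : MeasurableSet (Q1 A) :=
  (MeasurableSet.univ_pi fun _ => measurableSet_Icc).prod
    (MeasurableSet.univ_pi fun _ => measurableSet_Icc)

lemma vol_E0 (a : A) : volume (E0 a) = ENNReal.ofReal (1 / 2) ^ Fintype.card A := by
  classical
  unfold E0
  rw [volume_pi_pi, Finset.prod_congr rfl (g := fun _ => ENNReal.ofReal (1 / 2))]
  · simp
  · intro b _
    split_ifs
    · rw [Real.volume_Ioc]; norm_num
    · rw [Real.volume_Icc]; norm_num

lemma meas_E0 (a : A) : MeasurableSet (E0 a) := by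
  classical
  refine MeasurableSet.univ_pi fun b => ?_
  split_ifs
  · exact measurableSet_Ioc
  · exact measurableSet_Icc

lemma vol_E1 (a : A) : volume (E1 a) =
    ENNReal.ofReal (1 / 2) ^ Fintype.card A * ENNReal.ofReal (1 / 2) ^ Fintype.card A := by
  unfold E1
  rw [Measure.volume_eq_prod, Measure.prod_prod, vol_E0]

lemma meas_E1 (a : A) : MeasurableSet (E1 a) := (meas_E0 a).prod (meas_E0 a)

lemma E0_sub (a : A) : E0 a ⊆ Set.univ.pi fun _ => Set.Icc 0 1 := by
  classical
  refine Set.pi_mono fun b _ => ?_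
  split_ifs
  · exact fun x hx => ⟨by linarith [hx.1], hx.2⟩
  · exact fun x hx => ⟨hx.1, by linarith [hx.2]⟩

/-- The probability of failure in one state. -/
noncomputable def pf (A : Type) [Fintype A] : ENNReal :=
  1 - ENNReal.ofReal (1 / 2) ^ Fintype.card A * ENNReal.ofReal (1 / 2) ^ Fintype.card A

lemma pf_lt_one : pf A < 1 := by
  refine ENNReal.sub_lt_self ENNReal.one_ne_top one_ne_zero ?_
  have : ENNReal.ofReal (1 / 2) ≠ 0 := by simp
  exact mul_ne_zero (pow_ne_zero _ this) (pow_ne_zero _ this)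

lemma vol_diff (a : A) : volume (Q1 A \ E1 a) = pf A := by
  have hsub : E1 a ⊆ Q1 A := Set.prod_mono (E0_sub a) (E0_sub a)
  rw [measure_diff hsub (meas_E1 a).nullMeasurableSet, vol_Q1,
    vol_E1, pf]
  rw [vol_E1]
  finiteness

/-- Environments in the cube for which no state is good for `a`. -/
def Jset (Ω : Type) (a : A) : Set ((A × Ω → ℝ) × (A × Ω → ℝ)) :=
  {e | ∀ ω, ((fun b => e.1 (b, ω)), (fun b => e.2 (b, ω))) ∈ Q1 A \ E1 a}

lemma vol_Jset (a : A) : volume (Jset Ω a) = pf A ^ Fintype.card Ω := by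
  have hm : MeasurableSet (Jset Ω a) := by
    unfold Jset
    rw [Set.setOf_forall]
    refine MeasurableSet.iInter fun ω => ?_
    refine (meas_Q1.diff (meas_E1 a)).preimage (f := fun e : (A × Ω → ℝ) × (A × Ω → ℝ) =>
      ((fun b => e.1 (b, ω)), (fun b => e.2 (b, ω)))) ?_
    fun_prop
  rw [← mp_env.measure_preimage hm.nullMeasurableSet]
  have : (fun (f : Ω → (A → ℝ) × (A → ℝ)) =>
      ((fun p : A × Ω => (f p.2).1 p.1), (fun p : A × Ω => (f p.2).2 p.1))) ⁻¹' (Jset Ω a) =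
      Set.univ.pi fun _ => Q1 A \ E1 a := by
    ext f
    simp [Jset]
  rw [this, volume_pi_pi]
  simp [vol_diff]

lemma E0_ideal {a : A} {v : A → ℝ} (hv : v ∈ E0 a) : ∀ b, b ≠ a → v b < v a := by
  classical
  intro b hb
  have h1 := hv b (Set.mem_univ _)
  have h2 := hv a (Set.mem_univ _)
  simp only [hb, if_true, if_false] at h1 h2
  exact lt_of_le_of_lt h1.2 h2.1

lemma vol_notJI :
    volume (EnvCube Ω A ∩ {e | ¬ JointlyInclusive e.1 e.2}) ≤
      Fintype.card A * pf A ^ Fintype.card Ω := by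
  have hsub : EnvCube Ω A ∩ {e | ¬ JointlyInclusive e.1 e.2} ⊆ ⋃ a : A, Jset Ω a := by
    rintro e ⟨⟨hc1, hc2⟩, hJ⟩
    simp only [JointlyInclusive, Set.mem_setOf_eq, not_forall] at hJ
    obtain ⟨a, ha⟩ := hJ
    refine Set.mem_iUnion.2 ⟨a, fun ω => ⟨⟨fun b _ => hc1 _, fun b _ => hc2 _⟩, fun hE => ?_⟩⟩
    exact ha ⟨ω, E0_ideal hE.1, E0_ideal hE.2⟩
  refine (measure_mono hsub).trans ((measure_iUnion_fintype_le _ _).trans ?_)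
  simp [vol_Jset]

lemma vol_cube : volume (EnvCube Ω A) < ⊤ := by
  refine lt_of_le_of_lt (measure_mono ?_)
    (isCompact_Icc (a := (0 : (A × Ω → ℝ) × (A × Ω → ℝ)))
      (b := (fun _ => 1, fun _ => 1))).measure_lt_top
  rintro e ⟨h1, h2⟩
  exact ⟨⟨fun p => (h1 p).1, fun p => (h2 p).1⟩, ⟨fun p => (h1 p).2, fun p => (h2 p).2⟩⟩

/-- Lemma (Kamenica–Lin): as `|Ω| → ∞`, the share of environments where commitment
has no value converges to the share of felicitous environments. -/
theorem share_no_value_tendsto_share_felicitous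
    (A : Type) [Fintype A] [Nonempty A] :
    ∀ ε : ℝ, 0 < ε → ∃ N : ℕ,
      ∀ (Ω : Type) [Fintype Ω] [Nonempty Ω], N ≤ Fintype.card Ω →
      ∀ (M : Type) [Fintype M],
        max (Fintype.card Ω) (Fintype.card A) < Fintype.card M →
      ∀ μ₀ : Ω → ℝ, IsPrior μ₀ →
        |(volume (EnvCube Ω A ∩
            {e | ¬ (ctPayoff (M := M) μ₀ e.1 e.2 < persPayoff (M := M) μ₀ e.1 e.2)})).toReal
          - (volume (EnvCube Ω A ∩ {e | Felicitous μ₀ e.1 e.2})).toReal| < ε := by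
  intro ε hε
  have hlim : Filter.Tendsto (fun n : ℕ => (Fintype.card A : ENNReal) * pf A ^ n)
      Filter.atTop (nhds 0) := by
    have h := ENNReal.Tendsto.const_mul (a := (Fintype.card A : ENNReal))
      (ENNReal.tendsto_pow_atTop_nhds_zero_of_lt_one (pf_lt_one (A := A)))
      (Or.inr (ENNReal.natCast_ne_top _))
    simpa using h
  obtain ⟨N, hN⟩ := Filter.eventually_atTop.1
    (hlim.eventually (Iio_mem_nhds (ENNReal.ofReal_pos.2 hε)))
  refine ⟨N, fun Ω _ _ hΩ M _ hM μ₀ hμ => ?_⟩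
  have hMA : Fintype.card A < Fintype.card M := lt_of_le_of_lt (le_max_right _ _) hM
  have hMne : Nonempty M := Fintype.card_pos_iff.1 (by omega)
  set X := EnvCube Ω A ∩
    {e | ¬ (ctPayoff (M := M) μ₀ e.1 e.2 < persPayoff (M := M) μ₀ e.1 e.2)} with hX
  set Y := EnvCube Ω A ∩ {e | Felicitous μ₀ e.1 e.2} with hY
  set J := EnvCube Ω A ∩ {e | ¬ JointlyInclusive e.1 e.2} with hJ
  have hJε : volume J < ENNReal.ofReal ε := lt_of_le_of_lt vol_notJI (hN _ hΩ)
  have hnull := measure_union_null (measure_union_null (noTies_null (Ω := Ω) (A := A))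
    (noRTies_null (A := A) hμ)) (nonUniq_null (A := A) hμ)
  set Z := ({e : (A × Ω → ℝ) × (A × Ω → ℝ) | ¬ NoTies e.1} ∪ {e | ¬ NoRTies μ₀ e.2}) ∪
    {e | NonUniq μ₀ e.1 e.2} with hZ
  have hXY : X ⊆ (Y ∪ J) ∪ Z := by
    rintro e ⟨hc, hv⟩
    by_contra hcon
    simp only [hY, hJ, hZ, Set.mem_union, Set.mem_inter_iff, Set.mem_setOf_eq, not_or, not_and,
      not_not] at hcon
    obtain ⟨⟨h1, h2⟩, ⟨h3, h4⟩, h5⟩ := hcon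
    refine h1 hc (felicitous_of_noValue (M := M) hμ hMA h3 h4 (h2 hc) ?_ (not_lt.1 hv))
    intro x y hx hy
    by_contra hne
    exact h5 ⟨x, y, hx, hy, hne⟩
  have hYX : Y ⊆ X ∪ Z := by
    rintro e ⟨hc, hf⟩
    by_cases ht : NoTies e.1
    · exact Or.inl ⟨hc, not_lt.2 (noValue_of_felicitous hμ hMA ht hf)⟩
    · exact Or.inr (Or.inl (Or.inl ht))
  have hXtop : volume X ≠ ⊤ := (lt_of_le_of_lt (measure_mono Set.inter_subset_left) vol_cube).ne
  have hYtop : volume Y ≠ ⊤ := (lt_of_le_of_lt (measure_mono Set.inter_subset_left) vol_cube).ne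
  have hJtop : volume J ≠ ⊤ := (lt_of_le_of_lt (measure_mono Set.inter_subset_left) vol_cube).ne
  have h1 : volume X ≤ volume Y + volume J := by
    calc volume X ≤ volume ((Y ∪ J) ∪ Z) := measure_mono hXY
      _ ≤ volume (Y ∪ J) + volume Z := measure_union_le _ _
      _ = volume (Y ∪ J) := by rw [hnull, add_zero]
      _ ≤ _ := measure_union_le _ _
  have h2 : volume Y ≤ volume X := by
    calc volume Y ≤ volume (X ∪ Z) := measure_mono hYX
      _ ≤ volume X + volume Z := measure_union_le _ _
      _ = volume X := by rw [hnull, add_zero]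
  have h1' : (volume X).toReal ≤ (volume Y).toReal + (volume J).toReal := by
    rw [← ENNReal.toReal_add hYtop hJtop]
    exact ENNReal.toReal_mono (ENNReal.add_ne_top.2 ⟨hYtop, hJtop⟩) h1
  have h2' : (volume Y).toReal ≤ (volume X).toReal := ENNReal.toReal_mono hXtop h2
  have h3' : (volume J).toReal < ε := by
    rw [← ENNReal.toReal_ofReal hε.le]
    exact (ENNReal.toReal_lt_toReal hJtop ENNReal.ofReal_ne_top).2 hJε
  rw [abs_lt]
  constructor <;> linarith

end KL
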